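/- For every R > 0 there exists a constant C > 0 such that for every integer n ≥ 1 and all s ∈ [-R, R], one has |h_{n-1}(s)² + h_n(s)² - √2/(π √n)| ≤ C/n. -/

import Mathlib

noncomputable section

open MeasureTheory ProbabilityTheory Real Filter Finset

/-- Physicists' Hermite polynomials: `H 0 = 1`, `H 1 x = 2 * x`,
`H (n+2) x = 2 * x * H (n+1) x - 2 * (n+1) * H n x`. -/
def physHermite : ℕ → ℝ → ℝ
  | 0, _ => 1
  | 1, x => 2 * x
  | (n + 2), x => 2 * x * physHermite (n + 1) x - 2 * (n + 1) * physHermite n x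

/-- The `L²(ℝ)`-normalized Hermite functions. -/
def hermiteFun (n : ℕ) (x : ℝ) : ℝ :=
  physHermite n x * Real.exp (-x ^ 2 / 2) /
    Real.sqrt (n.factorial * 2 ^ n * Real.sqrt Real.pi)

theorem physHermite_succ_succ (n : ℕ) (x : ℝ) :
    physHermite (n + 2) x = 2 * x * physHermite (n + 1) x - 2 * (n + 1) * physHermite n x := by
  rw [physHermite]

theorem hasDerivAt_physHermite_succ (n : ℕ) (x : ℝ) :
    HasDerivAt (physHermite (n + 1)) (2 * (n + 1) * physHermite n x) x := by
  induction n using Nat.strong_induction_on with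
  | _ n ih =>
    match n with
    | 0 =>
      have h : physHermite (0 + 1) = fun y => 2 * y := by funext y; rw [physHermite]
      rw [h, physHermite]
      simpa using (hasDerivAt_id x).const_mul 2
    | 1 =>
      have h : physHermite (1 + 1) = fun y => 2 * y * (2 * y) - 2 := by
        funext y
        rw [physHermite_succ_succ, physHermite, physHermite]
        simp
      rw [h, physHermite]
      have h1 : HasDerivAt (fun y : ℝ => 2 * y) 2 x := by
        simpa using (hasDerivAt_id x).const_mul 2
      refine ((h1.fun_mul h1).sub_const 2).congr_deriv ?_
      push_cast
      ring
    | m + 2 =>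
      have h : physHermite (m + 2 + 1) = fun y => 2 * y * physHermite (m + 2) y
          - 2 * ((m + 1 : ℕ) + 1) * physHermite (m + 1) y := by
        funext y; exact physHermite_succ_succ (m + 1) y
      rw [h]
      have h1 : HasDerivAt (fun y : ℝ => 2 * y) 2 x := by
        simpa using (hasDerivAt_id x).const_mul 2
      have ih1 := ih (m + 1) (by omega)
      have ih0 := (ih m (by omega)).const_mul (2 * (((m + 1 : ℕ) : ℝ) + 1))
      refine ((h1.fun_mul ih1).fun_sub ih0).congr_deriv ?_
      rw [physHermite_succ_succ m x]
      push_cast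
      ring

theorem hasDerivAt_physHermite (n : ℕ) (x : ℝ) :
    HasDerivAt (physHermite n) (2 * x * physHermite n x - physHermite (n + 1) x) x := by
  cases n with
  | zero =>
    have h : physHermite 0 = fun _ => 1 := by funext y; rw [physHermite]
    have h1 : physHermite (0 + 1) x = 2 * x := by rw [physHermite]
    rw [h1, h]
    simpa using hasDerivAt_const x (1 : ℝ)
  | succ n =>
    refine HasDerivAt.congr_deriv (hasDerivAt_physHermite_succ n x) ?_
    rw [physHermite_succ_succ]
    ring

theorem hasDerivAt_exp_neg_sq_half (x : ℝ) :
    HasDerivAt (fun y : ℝ => Real.exp (-y ^ 2 / 2)) (-x * Real.exp (-x ^ 2 / 2)) x := by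
  refine HasDerivAt.congr_deriv ((((hasDerivAt_pow 2 x).fun_neg).div_const 2).exp) ?_
  simp
  ring

theorem sqrt_hermite_norm_succ (n : ℕ) :
    Real.sqrt ((n + 1).factorial * 2 ^ (n + 1) * Real.sqrt Real.pi) =
      Real.sqrt (2 * (n + 1)) * Real.sqrt (n.factorial * 2 ^ n * Real.sqrt Real.pi) := by
  rw [← Real.sqrt_mul (by positivity), Nat.factorial_succ]
  congr 1
  push_cast
  ring

theorem hasDerivAt_hermiteFun (n : ℕ) (x : ℝ) :
    HasDerivAt (hermiteFun n)
      (x * hermiteFun n x - Real.sqrt (2 * (n + 1)) * hermiteFun (n + 1) x) x := by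
  have h := ((hasDerivAt_physHermite n x).fun_mul (hasDerivAt_exp_neg_sq_half x)).div_const
    (Real.sqrt (n.factorial * 2 ^ n * Real.sqrt Real.pi))
  refine h.congr_deriv ?_
  have hs : Real.sqrt (2 * ((n : ℝ) + 1)) ≠ 0 := by positivity
  have hN : Real.sqrt (n.factorial * 2 ^ n * Real.sqrt Real.pi) ≠ 0 := by positivity
  rw [hermiteFun, hermiteFun, sqrt_hermite_norm_succ]
  field_simp
  ring

theorem hasDerivAt_hermiteFun_succ (n : ℕ) (x : ℝ) :
    HasDerivAt (hermiteFun (n + 1))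
      (Real.sqrt (2 * (n + 1)) * hermiteFun n x - x * hermiteFun (n + 1) x) x := by
  have h := ((hasDerivAt_physHermite_succ n x).fun_mul (hasDerivAt_exp_neg_sq_half x)).div_const
    (Real.sqrt ((n + 1).factorial * 2 ^ (n + 1) * Real.sqrt Real.pi))
  refine h.congr_deriv ?_
  have hs : Real.sqrt (2 * ((n : ℝ) + 1)) ≠ 0 := by positivity
  have hs2 : Real.sqrt (2 * ((n : ℝ) + 1)) ^ 2 = 2 * (n + 1) := Real.sq_sqrt (by positivity)
  have hN : Real.sqrt (n.factorial * 2 ^ n * Real.sqrt Real.pi) ≠ 0 := by positivity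
  rw [hermiteFun, hermiteFun, sqrt_hermite_norm_succ]
  field_simp
  rw [hs2]
  ring

theorem hermiteFun_sq_add_sq_le (n : ℕ) (x : ℝ) :
    hermiteFun n x ^ 2 + hermiteFun (n + 1) x ^ 2 ≤
      (hermiteFun n 0 ^ 2 + hermiteFun (n + 1) 0 ^ 2) * Real.exp (x ^ 2) := by
  set E : ℝ → ℝ := fun y =>
    (hermiteFun n y ^ 2 + hermiteFun (n + 1) y ^ 2) * Real.exp (-y ^ 2) with hE
  have hd (y : ℝ) : HasDerivAt E (-y * (4 * hermiteFun (n + 1) y ^ 2 * Real.exp (-y ^ 2))) y := by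
    have h := (((hasDerivAt_hermiteFun n y).fun_pow 2).fun_add
      ((hasDerivAt_hermiteFun_succ n y).fun_pow 2)).fun_mul ((hasDerivAt_pow 2 y).fun_neg.exp)
    refine h.congr_deriv ?_
    simp
    ring
  have hc : Continuous E := continuous_iff_continuousAt.2 fun y => (hd y).continuousAt
  have key : E x ≤ E 0 := by
    rcases le_total 0 x with hx | hx
    · refine antitoneOn_of_deriv_nonpos (convex_Ici 0) hc.continuousOn
        (fun y _ => (hd y).differentiableAt.differentiableWithinAt) (fun y hy => ?_)
        Set.self_mem_Ici hx hx
      rw [interior_Ici, Set.mem_Ioi] at hy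
      rw [(hd y).deriv]
      exact mul_nonpos_of_nonpos_of_nonneg (by linarith) (by positivity)
    · refine monotoneOn_of_deriv_nonneg (convex_Iic 0) hc.continuousOn
        (fun y _ => (hd y).differentiableAt.differentiableWithinAt) (fun y hy => ?_)
        hx Set.self_mem_Iic hx
      rw [interior_Iic, Set.mem_Iio] at hy
      rw [(hd y).deriv]
      exact mul_nonneg (by linarith) (by positivity)
  simp only [hE, Real.exp_neg, ← div_eq_mul_inv] at key
  rw [div_le_iff₀ (Real.exp_pos _)] at key
  simpa using key

/-- The derivative of `h n ^ 2 + h (n + 1) ^ 2` is `2 * x / √(2 * (n + 1))` times that of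
`h n * h (n + 1)`, so the former function varies slowly on bounded intervals. -/
theorem abs_hermiteFun_sq_add_sq_sub_le (n : ℕ) {R s : ℝ} (hs : s ∈ Set.Icc (-R) R) :
    |hermiteFun n s ^ 2 + hermiteFun (n + 1) s ^ 2 -
        (hermiteFun n 0 ^ 2 + hermiteFun (n + 1) 0 ^ 2)| ≤
      2 * R * Real.exp (R ^ 2) / Real.sqrt (2 * (n + 1)) *
        (hermiteFun n 0 ^ 2 + hermiteFun (n + 1) 0 ^ 2) := by
  set A := hermiteFun n 0 ^ 2 + hermiteFun (n + 1) 0 ^ 2 with hA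
  set c := Real.sqrt (2 * ((n : ℝ) + 1)) with hc
  have hc0 : 0 < c := by positivity
  have hA0 : 0 ≤ A := by positivity
  have hR : 0 ≤ R := by linarith [hs.1, hs.2]
  have hsR : |s| ≤ R := abs_le.2 hs
  have hG : ∀ y ∈ Set.Icc (-R) R,
      |hermiteFun n y * hermiteFun (n + 1) y| ≤ A * Real.exp (R ^ 2) / 2 := by
    intro y hy
    have h1 := hermiteFun_sq_add_sq_le n y
    have h2 : A * Real.exp (y ^ 2) ≤ A * Real.exp (R ^ 2) := by
      gcongr A * Real.exp ?_
      exact sq_le_sq' hy.1 hy.2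
    rw [abs_le]
    constructor <;> nlinarith [sq_nonneg (hermiteFun n y + hermiteFun (n + 1) y),
      sq_nonneg (hermiteFun n y - hermiteFun (n + 1) y)]
  set Φ : ℝ → ℝ := fun y => hermiteFun n y ^ 2 + hermiteFun (n + 1) y ^ 2 -
    2 / c * y * (hermiteFun n y * hermiteFun (n + 1) y) with hΦ
  have hd (y : ℝ) : HasDerivAt Φ (-(2 / c) * (hermiteFun n y * hermiteFun (n + 1) y)) y := by
    have hf := hasDerivAt_hermiteFun n y
    have hg := hasDerivAt_hermiteFun_succ n y
    rw [← hc] at hf hg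
    have h := ((hf.fun_pow 2).fun_add (hg.fun_pow 2)).fun_sub
      (((hasDerivAt_id' y).const_mul (2 / c)).fun_mul (hf.fun_mul hg))
    refine h.congr_deriv ?_
    field_simp
    ring
  have hmv := (convex_Icc (-R) R).norm_image_sub_le_of_norm_hasDerivWithin_le
    (C := 2 / c * (A * Real.exp (R ^ 2) / 2)) (fun y _ => (hd y).hasDerivWithinAt)
    (fun y hy => by
      rw [norm_mul, norm_neg, Real.norm_of_nonneg (by positivity)]
      exact mul_le_mul_of_nonneg_left (hG y hy) (by positivity))
    (show (0 : ℝ) ∈ Set.Icc (-R) R from ⟨by linarith, hR⟩) hs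
  rw [Real.norm_eq_abs, Real.norm_eq_abs, sub_zero] at hmv
  have h1 : |Φ s - Φ 0| ≤ 2 / c * (A * Real.exp (R ^ 2) / 2) * R :=
    hmv.trans (mul_le_mul_of_nonneg_left hsR (by positivity))
  have h2 : |2 / c * s * (hermiteFun n s * hermiteFun (n + 1) s)| ≤
      2 / c * R * (A * Real.exp (R ^ 2) / 2) := by
    rw [abs_mul, abs_mul, abs_of_nonneg (by positivity : 0 ≤ 2 / c)]
    gcongr
    exact hG s hs
  have h3 : hermiteFun n s ^ 2 + hermiteFun (n + 1) s ^ 2 - A =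
      (Φ s - Φ 0) + 2 / c * s * (hermiteFun n s * hermiteFun (n + 1) s) := by
    simp only [hΦ, hA]
    ring
  rw [h3]
  refine ((abs_add_le _ _).trans (add_le_add h1 h2)).trans (le_of_eq ?_)
  ring

theorem physHermite_odd_zero (m : ℕ) : physHermite (2 * m + 1) 0 = 0 := by
  induction m with
  | zero => simp [physHermite]
  | succ m ih =>
    rw [show 2 * (m + 1) + 1 = (2 * m + 1) + 2 by ring, physHermite_succ_succ, ih]
    simp

theorem physHermite_even_zero (m : ℕ) :
    physHermite (2 * m) 0 = (-1) ^ m * (2 * m).factorial / m.factorial := by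
  induction m with
  | zero => simp [physHermite]
  | succ m ih =>
    rw [show 2 * (m + 1) = 2 * m + 2 by ring, physHermite_succ_succ, ih,
      Nat.factorial_succ, Nat.factorial_succ, Nat.factorial_succ]
    push_cast
    field_simp
    ring

theorem hermiteFun_odd_zero (m : ℕ) : hermiteFun (2 * m + 1) 0 = 0 := by
  simp [hermiteFun, physHermite_odd_zero]

theorem hermiteFun_even_zero_pow_four (m : ℕ) :
    hermiteFun (2 * m) 0 ^ 4 = 1 / (Real.Wallis.W m * (2 * m + 1) * π) := by
  have hN : Real.sqrt ((2 * m).factorial * 2 ^ (2 * m) * Real.sqrt Real.pi) ^ 4 =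
      ((2 * m).factorial * 2 ^ (2 * m)) ^ 2 * π := by
    rw [show 4 = 2 * 2 by norm_num, pow_mul, Real.sq_sqrt (by positivity), mul_pow,
      Real.sq_sqrt pi_pos.le]
  rw [hermiteFun, physHermite_even_zero, Real.Wallis.W_eq_factorial_ratio, div_pow, hN]
  have h1 : ((-1 : ℝ) ^ m) ^ 4 = 1 := by
    rw [← pow_mul, mul_comm, pow_mul]; norm_num
  simp only [ne_eq, OfNat.ofNat_ne_zero, not_false_eq_true, zero_pow, neg_zero, zero_div,
    Real.exp_zero, mul_one, div_pow, mul_pow, h1]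
  field_simp
  ring

theorem hermiteFun_even_zero_pow_four_bounds (m : ℕ) :
    2 / (π ^ 2 * (2 * m + 1)) ≤ hermiteFun (2 * m) 0 ^ 4 ∧
      hermiteFun (2 * m) 0 ^ 4 ≤ 2 * (2 * m + 2) / (π ^ 2 * (2 * m + 1) ^ 2) := by
  have hW := Real.Wallis.W_pos m
  have hle := Real.Wallis.W_le m
  have hge := Real.Wallis.le_W m
  have hpi := pi_pos
  rw [hermiteFun_even_zero_pow_four]
  constructor
  · calc 2 / (π ^ 2 * (2 * m + 1)) = 1 / (π / 2 * (2 * m + 1) * π) := by field_simp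
      _ ≤ _ := by gcongr
  · calc 1 / (Real.Wallis.W m * (2 * m + 1) * π)
        ≤ 1 / (((2 : ℝ) * m + 1) / (2 * m + 2) * (π / 2) * (2 * m + 1) * π) := by gcongr
      _ = _ := by field_simp

theorem abs_hermiteFun_zero_sq_add_sq_sq_sub_le (n : ℕ) :
    |(hermiteFun n 0 ^ 2 + hermiteFun (n + 1) 0 ^ 2) ^ 2 - 2 / (π ^ 2 * (n + 1))| ≤
      2 / (π ^ 2 * (n + 1) ^ 2) := by
  have hpi := pi_pos
  rcases Nat.even_or_odd' n with ⟨m, rfl | rfl⟩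
  · obtain ⟨h1, h2⟩ := hermiteFun_even_zero_pow_four_bounds m
    rw [hermiteFun_odd_zero, abs_le]
    push_cast
    have h3 : 2 * (2 * (m : ℝ) + 2) / (π ^ 2 * (2 * m + 1) ^ 2) =
        2 / (π ^ 2 * (2 * m + 1)) + 2 / (π ^ 2 * (2 * m + 1) ^ 2) := by
      field_simp; ring
    have h4 : 0 ≤ 2 / (π ^ 2 * (2 * (m : ℝ) + 1) ^ 2) := by positivity
    constructor <;> nlinarith
  · obtain ⟨h1, h2⟩ := hermiteFun_even_zero_pow_four_bounds (m + 1)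
    rw [hermiteFun_odd_zero, abs_le, show 2 * m + 1 + 1 = 2 * (m + 1) by ring]
    push_cast at h1 h2 ⊢
    have h3 : 2 * (2 * ((m : ℝ) + 1) + 2) / (π ^ 2 * (2 * (m + 1) + 1) ^ 2) ≤
        2 / (π ^ 2 * (2 * m + 1 + 1)) + 2 / (π ^ 2 * (2 * m + 1 + 1) ^ 2) := by
      rw [div_add_div _ _ (by positivity) (by positivity),
        div_le_div_iff₀ (by positivity) (by positivity), ← sub_nonneg]
      ring_nf
      positivity
    have h4 : 2 / (π ^ 2 * (2 * (m : ℝ) + 1 + 1)) - 2 / (π ^ 2 * (2 * m + 1 + 1) ^ 2) ≤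
        2 / (π ^ 2 * (2 * (m + 1) + 1)) := by
      rw [div_sub_div _ _ (by positivity) (by positivity),
        div_le_div_iff₀ (by positivity) (by positivity), ← sub_nonneg]
      ring_nf
      positivity
    constructor <;> nlinarith

theorem abs_hermiteFun_zero_sq_add_sq_sub_le (n : ℕ) :
    |hermiteFun n 0 ^ 2 + hermiteFun (n + 1) 0 ^ 2 - Real.sqrt 2 / (π * Real.sqrt (n + 1))| ≤
      1 / (n + 1) := by
  have h := abs_hermiteFun_zero_sq_add_sq_sq_sub_le n
  set a := hermiteFun n 0 ^ 2 + hermiteFun (n + 1) 0 ^ 2 with ha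
  set r := Real.sqrt ((n : ℝ) + 1) with hr
  have hr2 : (n : ℝ) + 1 = r ^ 2 := (Real.sq_sqrt (by positivity)).symm
  have hr1 : 1 ≤ r := Real.one_le_sqrt.2 (by linarith [(n.cast_nonneg : (0 : ℝ) ≤ n)])
  have ha0 : 0 ≤ a := by positivity
  have hpi := pi_gt_three
  have hs2 : Real.sqrt 2 ^ 2 = 2 := Real.sq_sqrt (by norm_num)
  have hs1 : 1 ≤ Real.sqrt 2 := Real.one_le_sqrt.2 (by norm_num)
  set b := Real.sqrt 2 / (π * r) with hb
  have hb0 : 0 < b := by positivity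
  have hb2 : 2 / (π ^ 2 * r ^ 2) = b ^ 2 := by rw [hb, div_pow, hs2, mul_pow]
  rw [hr2, hb2] at h
  rw [hr2]
  have h1 : |a - b| * b ≤ |a ^ 2 - b ^ 2| := by
    rw [show a ^ 2 - b ^ 2 = (a - b) * (a + b) by ring, abs_mul,
      abs_of_nonneg (by positivity : 0 ≤ a + b)]
    gcongr
    linarith
  have h2 : 2 / (π ^ 2 * (r ^ 2) ^ 2) ≤ 1 / r ^ 2 * b := by
    rw [hb, div_mul_div_comm, div_le_div_iff₀ (by positivity) (by positivity)]
    have : 2 ≤ Real.sqrt 2 * π * r := by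
      have := mul_le_mul hs1 hr1 (by norm_num) (by positivity)
      nlinarith
    have h5 : 0 ≤ π * r ^ 3 := by positivity
    nlinarith [mul_le_mul_of_nonneg_right this h5]
  exact le_of_mul_le_mul_right (h1.trans (h.trans h2)) hb0

theorem statement11 (R : ℝ) (hR : 0 < R) :
    ∃ C : ℝ, 0 < C ∧ ∀ n : ℕ, 1 ≤ n → ∀ s : ℝ, s ∈ Set.Icc (-R) R →
      |hermiteFun (n - 1) s ^ 2 + hermiteFun n s ^ 2 -
          Real.sqrt 2 / (Real.pi * Real.sqrt n)| ≤ C / n := by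
  refine ⟨4 * R * Real.exp (R ^ 2) + 1, by positivity, fun n hn s hs => ?_⟩
  obtain ⟨k, rfl⟩ := Nat.exists_eq_add_of_le' hn
  rw [Nat.add_sub_cancel]
  have h1 := abs_hermiteFun_sq_add_sq_sub_le k hs
  have h2 := abs_hermiteFun_zero_sq_add_sq_sub_le k
  push_cast
  set A := hermiteFun k 0 ^ 2 + hermiteFun (k + 1) 0 ^ 2 with hA
  set r := Real.sqrt ((k : ℝ) + 1) with hr
  have hr2 : (k : ℝ) + 1 = r ^ 2 := (Real.sq_sqrt (by positivity)).symm
  have hr1 : 1 ≤ r := Real.one_le_sqrt.2 (by linarith [(k.cast_nonneg : (0 : ℝ) ≤ k)])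
  have hs2 : Real.sqrt 2 ≤ 2 := Real.sqrt_le_iff.2 (by norm_num)
  have hb : Real.sqrt 2 / (π * r) ≤ 1 / r := by
    rw [div_le_div_iff₀ (by positivity) (by positivity)]
    nlinarith [pi_gt_three]
  have hr3 : 1 / r ^ 2 ≤ 1 / r := one_div_le_one_div_of_le (by positivity) (by nlinarith)
  have hA2 : A ≤ 2 / r := by
    rw [hr2] at h2
    have h3 := (abs_le.1 h2).2
    rw [show 2 / r = 1 / r + 1 / r by ring]
    linarith
  have hsr : r ≤ Real.sqrt (2 * ((k : ℝ) + 1)) := Real.sqrt_le_sqrt (by linarith)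
  have h4 : 2 * R * Real.exp (R ^ 2) / Real.sqrt (2 * (k + 1)) * A ≤
      4 * R * Real.exp (R ^ 2) / (k + 1) := by
    calc _ ≤ 2 * R * Real.exp (R ^ 2) / r * (2 / r) := by gcongr
      _ = _ := by rw [hr2]; field_simp; ring
  rw [add_div]
  exact (abs_sub_le _ A _).trans (add_le_add (h1.trans h4) h2)

end
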